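/- arXiv:2006.00409 — 5 statements merged into one kernel-verified Lean document; each statement's English description precedes it below -/
import Mathlib

section
/- Suppose D > 0 and ρ·D ≥ 2·c, and set θ = c/(ρ·D). Then the pair (u_θ, v_θ) is a global minimizer of g, i.e., for all u, v ∈ ℝ^d one has g(u_θ, v_θ) ≤ g(u, v). (This is the unified closed-form solution of the ADMM u-update in Lemma 2.1, in the regime where θ ≤ 1/2.) -/
/-- Lower bound for a norm penalty plus two quadratic terms, by the triangle inequality and
completing squares. -/
theorem norm_add_sub_penalty_lower_bound {E : Type*} [SeminormedAddCommGroup E]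
    (a b α u v : E) {t ρ : ℝ} (ht : 0 ≤ t) (hρ : 0 ≤ ρ) :
    ρ * t * ‖a - b + α‖ - ρ * t ^ 2 ≤
      ρ * t * ‖u + α - v‖ + ρ / 2 * (‖a - u‖ ^ 2 + ‖b - v‖ ^ 2) := by
  have htri : ‖a - b + α‖ ≤ ‖u + α - v‖ + ‖a - u‖ + ‖b - v‖ := by
    calc ‖a - b + α‖ = ‖(u + α - v) + (a - u) - (b - v)‖ := by congr 1; abel
      _ ≤ ‖(u + α - v) + (a - u)‖ + ‖b - v‖ := norm_sub_le _ _
      _ ≤ _ := by gcongr; exact norm_add_le _ _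
  have hmul := mul_le_mul_of_nonneg_left htri (mul_nonneg hρ ht)
  have hsq := mul_nonneg hρ (add_nonneg (sq_nonneg (‖a - u‖ - t)) (sq_nonneg (‖b - v‖ - t)))
  linarith

/-- Lemma 2.1, Case (1) regime (θ ≤ 1/2): when `D > 0` and `ρ·D ≥ 2·c`, with
`θ = c/(ρ·D)`, the pair `(u_θ, v_θ)` is a global minimizer of `g`. -/
theorem danr_lemma21_case1_global_min
    (d : ℕ) (hd : 1 ≤ d)
    (a b α : EuclideanSpace ℝ (Fin d)) (c ρ : ℝ) (hc : 0 ≤ c) (hρ : 0 < ρ)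
    (g : EuclideanSpace ℝ (Fin d) → EuclideanSpace ℝ (Fin d) → ℝ)
    (hg : ∀ u v, g u v = c * ‖u + α - v‖ + ρ / 2 * (‖a - u‖ ^ 2 + ‖b - v‖ ^ 2))
    (D : ℝ) (hDdef : D = ‖a - b + α‖)
    (uθ vθ : ℝ → EuclideanSpace ℝ (Fin d))
    (huθ : ∀ θ : ℝ, uθ θ = (1 - θ) • a + θ • b - θ • α)
    (hvθ : ∀ θ : ℝ, vθ θ = θ • a + (1 - θ) • b + θ • α)
    (hD : 0 < D) (hρD : ρ * D ≥ 2 * c) :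
    ∀ u v : EuclideanSpace ℝ (Fin d),
      g (uθ (c / (ρ * D))) (vθ (c / (ρ * D))) ≤ g u v := by
  intro u v
  have hρDpos : 0 < ρ * D := mul_pos hρ hD
  set θ := c / (ρ * D) with hθ
  have hθ0 : 0 ≤ θ := div_nonneg hc hρDpos.le
  have hcθ : c = ρ * (θ * D) := by rw [hθ]; field_simp
  have hθ2 : 0 ≤ 1 - 2 * θ := by
    have : θ ≤ 1 / 2 := by rw [hθ, div_le_iff₀ hρDpos]; linarith
    linarith
  have hw : ‖uθ θ + α - vθ θ‖ = (1 - 2 * θ) * D := by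
    rw [hDdef, ← norm_smul_of_nonneg hθ2, huθ, hvθ]
    congr 1; module
  have ha : ‖a - uθ θ‖ = θ * D := by
    rw [hDdef, ← norm_smul_of_nonneg hθ0, huθ]
    congr 1; module
  have hb : ‖b - vθ θ‖ = θ * D := by
    rw [hDdef, ← norm_smul_of_nonneg hθ0, hvθ, ← norm_neg]
    congr 1; module
  have hlow := norm_add_sub_penalty_lower_bound a b α u v (mul_nonneg hθ0 hD.le) hρ.le
  rw [← hDdef, ← hcθ] at hlow
  rw [hg, hg, hw, ha, hb]
  refine le_trans (le_of_eq ?_) hlow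
  rw [hcθ]
  ring
end

section
/- Suppose ρ·D ≤ 2·c (in particular this covers D = 0). Then the consensus pair (u_{1/2}, v_{1/2}) = ((a + b − α)/2, (a + b + α)/2) is a global minimizer of g, i.e., for all u, v ∈ ℝ^d one has g(u_{1/2}, v_{1/2}) ≤ g(u, v). (This is Case (2) of Lemma 2.1, where the minimizer satisfies u + α − v = 0.) -/
/-- Lemma 2.1, Case (2): when `ρ·D ≤ 2·c` (in particular when `D = 0`), the consensus
pair `(u_{1/2}, v_{1/2}) = ((a+b-α)/2, (a+b+α)/2)` is a global minimizer of `g`. -/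
theorem danr_lemma21_case2_global_min
    (d : ℕ) (hd : 1 ≤ d)
    (a b α : EuclideanSpace ℝ (Fin d)) (c ρ : ℝ) (hc : 0 ≤ c) (hρ : 0 < ρ)
    (g : EuclideanSpace ℝ (Fin d) → EuclideanSpace ℝ (Fin d) → ℝ)
    (hg : ∀ u v, g u v = c * ‖u + α - v‖ + ρ / 2 * (‖a - u‖ ^ 2 + ‖b - v‖ ^ 2))
    (D : ℝ) (hDdef : D = ‖a - b + α‖)
    (uθ vθ : ℝ → EuclideanSpace ℝ (Fin d))
    (huθ : ∀ θ : ℝ, uθ θ = (1 - θ) • a + θ • b - θ • α)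
    (hvθ : ∀ θ : ℝ, vθ θ = θ • a + (1 - θ) • b + θ • α)
    (hρD : ρ * D ≤ 2 * c) :
    ∀ u v : EuclideanSpace ℝ (Fin d),
      g (uθ (1 / 2)) (vθ (1 / 2)) ≤ g u v := by
  intro u v
  have hw : uθ (1 / 2) + α - vθ (1 / 2) = 0 := by
    rw [huθ, hvθ]; module
  have ha : a - uθ (1 / 2) = (1 / 2 : ℝ) • (a - b + α) := by
    rw [huθ]; module
  have hb : b - vθ (1 / 2) = (-(1 / 2) : ℝ) • (a - b + α) := by
    rw [hvθ]; module
  have hmin : g (uθ (1 / 2)) (vθ (1 / 2)) = ρ / 4 * D ^ 2 := by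
    rw [hg, hw, ha, hb, norm_smul, norm_smul, ← hDdef, norm_neg, norm_zero,
      Real.norm_of_nonneg (by norm_num : (0 : ℝ) ≤ 1 / 2)]
    ring
  have hD : 0 ≤ D := hDdef ▸ norm_nonneg _
  have htri : D ≤ ‖u + α - v‖ + ‖(a - u) - (b - v)‖ := by
    rw [hDdef, show a - b + α = (u + α - v) + ((a - u) - (b - v)) by abel]
    exact norm_add_le _ _
  have hpar : ‖(a - u) - (b - v)‖ ^ 2 ≤ 2 * (‖a - u‖ ^ 2 + ‖b - v‖ ^ 2) := by
    have h := parallelogram_law_with_norm ℝ (a - u) (b - v)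
    nlinarith [mul_self_nonneg ‖(a - u) + (b - v)‖]
  rw [hmin, hg]
  have ht := norm_nonneg (u + α - v)
  generalize ‖u + α - v‖ = t at *
  generalize ‖(a - u) - (b - v)‖ = s at *
  have hquad : D ^ 2 ≤ 2 * D * t + s ^ 2 := by
    nlinarith [sq_nonneg (s - D), mul_le_mul_of_nonneg_left htri hD]
  have h₁ := mul_le_mul_of_nonneg_right hρD ht
  have h₂ := mul_le_mul_of_nonneg_left hquad hρ.le
  have h₃ := mul_le_mul_of_nonneg_left hpar hρ.le
  linarith
end

section
/- Suppose c > 0, D > 0, and θ := c/(ρ·D) satisfies θ < 1/2. Then u_θ + α − v_θ ≠ 0, and the pair (u_θ, v_θ) satisfies the first-order stationarity conditions of g: c·(u_θ + α − v_θ)/‖u_θ + α − v_θ‖₂ − ρ·(a − u_θ) = 0 and −c·(u_θ + α − v_θ)/‖u_θ + α − v_θ‖₂ − ρ·(b − v_θ) = 0. -/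
/-- First-order stationarity of `(u_θ, v_θ)` for `θ = c/(ρD) < 1/2` (differentiable
Case (1) of Lemma 2.1): `u_θ + α - v_θ ≠ 0` and the gradient conditions hold. -/
theorem danr_lemma21_stationarity
    (d : ℕ) (hd : 1 ≤ d)
    (a b α : EuclideanSpace ℝ (Fin d)) (c ρ : ℝ) (hc : 0 ≤ c) (hρ : 0 < ρ)
    (D : ℝ) (hDdef : D = ‖a - b + α‖)
    (uθ vθ : ℝ → EuclideanSpace ℝ (Fin d))
    (huθ : ∀ θ : ℝ, uθ θ = (1 - θ) • a + θ • b - θ • α)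
    (hvθ : ∀ θ : ℝ, vθ θ = θ • a + (1 - θ) • b + θ • α)
    (hcpos : 0 < c) (hD : 0 < D)
    (θ : ℝ) (hθdef : θ = c / (ρ * D)) (hθlt : θ < 1 / 2) :
    uθ θ + α - vθ θ ≠ 0
    ∧ (c / ‖uθ θ + α - vθ θ‖) • (uθ θ + α - vθ θ) - ρ • (a - uθ θ) = 0
    ∧ -((c / ‖uθ θ + α - vθ θ‖) • (uθ θ + α - vθ θ)) - ρ • (b - vθ θ) = 0 := by
  have hgap : uθ θ + α - vθ θ = (1 - 2 * θ) • (a - b + α) := by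
    rw [huθ, hvθ]; module
  have hau : a - uθ θ = θ • (a - b + α) := by
    rw [huθ]; module
  have hbv : b - vθ θ = -(θ • (a - b + α)) := by
    rw [hvθ]; module
  have hpos : 0 < 1 - 2 * θ := by linarith
  have hnorm : ‖uθ θ + α - vθ θ‖ = (1 - 2 * θ) * D := by
    rw [hgap, norm_smul, Real.norm_of_nonneg hpos.le, hDdef]
  have hcoef : c / ((1 - 2 * θ) * D) * (1 - 2 * θ) = ρ * θ := by
    have hcθ : c = ρ * D * θ := by
      rw [hθdef]; field_simp
    rw [hcθ, div_mul_eq_mul_div, div_eq_iff (mul_pos hpos hD).ne']; ring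
  have hgrad : (c / ‖uθ θ + α - vθ θ‖) • (uθ θ + α - vθ θ) = (ρ * θ) • (a - b + α) := by
    rw [hnorm, hgap, smul_smul, hcoef]
  refine ⟨norm_pos_iff.mp (hnorm ▸ mul_pos hpos hD), ?_, ?_⟩
  · rw [hgrad, hau]; module
  · rw [hgrad, hbv]; module
end

section
/- Suppose D > 0 and ρ·D ≥ 2·c, and set θ = c/(ρ·D). Then the difference between the objective value at the Case-(1) candidate point and at the consensus point equals g(u_θ, v_θ) − g(u_{1/2}, v_{1/2}) = −(ρ/4)·(D − 2c/ρ)². Consequently g(u_θ, v_θ) ≤ g(u_{1/2}, v_{1/2}), with equality if and only if ρ·D = 2·c (i.e., θ = 1/2). (This is the comparison F₁* ≤ F₂* in the proof of Lemma 2.1.) -/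
/-- Value of `g` along the segment `θ ↦ (u_θ, v_θ)`: it depends on `a`, `b`, `α` only through
`‖a - b + α‖`. -/
theorem objective_on_segment {E : Type*} [NormedAddCommGroup E] [NormedSpace ℝ E]
    (a b α : E) (c ρ t : ℝ) :
    c * ‖((1 - t) • a + t • b - t • α) + α - (t • a + (1 - t) • b + t • α)‖
        + ρ / 2 * (‖a - ((1 - t) • a + t • b - t • α)‖ ^ 2
          + ‖b - (t • a + (1 - t) • b + t • α)‖ ^ 2)
      = c * (|1 - 2 * t| * ‖a - b + α‖) + ρ * t ^ 2 * ‖a - b + α‖ ^ 2 := by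
  have h₁ : ((1 - t) • a + t • b - t • α) + α - (t • a + (1 - t) • b + t • α)
      = (1 - 2 * t) • (a - b + α) := by module
  have h₂ : a - ((1 - t) • a + t • b - t • α) = t • (a - b + α) := by module
  have h₃ : b - (t • a + (1 - t) • b + t • α) = (-t) • (a - b + α) := by module
  rw [h₁, h₂, h₃, norm_smul, norm_smul, norm_smul]
  simp only [Real.norm_eq_abs, mul_pow, sq_abs, neg_sq]
  ring

/-- Comparison `F₁* ≤ F₂*` in the proof of Lemma 2.1: if `D > 0` and `ρD ≥ 2c`, with
`θ = c/(ρD)`, then `g(u_θ,v_θ) - g(u_{1/2},v_{1/2}) = -(ρ/4)(D - 2c/ρ)²`; hence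
`g(u_θ,v_θ) ≤ g(u_{1/2},v_{1/2})` with equality iff `ρD = 2c`. -/
theorem danr_lemma21_case_comparison
    (d : ℕ) (hd : 1 ≤ d)
    (a b α : EuclideanSpace ℝ (Fin d)) (c ρ : ℝ) (hc : 0 ≤ c) (hρ : 0 < ρ)
    (g : EuclideanSpace ℝ (Fin d) → EuclideanSpace ℝ (Fin d) → ℝ)
    (hg : ∀ u v, g u v = c * ‖u + α - v‖ + ρ / 2 * (‖a - u‖ ^ 2 + ‖b - v‖ ^ 2))
    (D : ℝ) (hDdef : D = ‖a - b + α‖)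
    (uθ vθ : ℝ → EuclideanSpace ℝ (Fin d))
    (huθ : ∀ θ : ℝ, uθ θ = (1 - θ) • a + θ • b - θ • α)
    (hvθ : ∀ θ : ℝ, vθ θ = θ • a + (1 - θ) • b + θ • α)
    (hD : 0 < D) (hρD : ρ * D ≥ 2 * c)
    (θ : ℝ) (hθdef : θ = c / (ρ * D)) :
    g (uθ θ) (vθ θ) - g (uθ (1 / 2)) (vθ (1 / 2)) = -(ρ / 4) * (D - 2 * c / ρ) ^ 2
    ∧ g (uθ θ) (vθ θ) ≤ g (uθ (1 / 2)) (vθ (1 / 2))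
    ∧ (g (uθ θ) (vθ θ) = g (uθ (1 / 2)) (vθ (1 / 2)) ↔ ρ * D = 2 * c) := by
  have hval : ∀ t, g (uθ t) (vθ t) = c * (|1 - 2 * t| * D) + ρ * t ^ 2 * D ^ 2 := fun t => by
    rw [hg, huθ, hvθ, hDdef, objective_on_segment]
  have hθ : 0 ≤ 1 - 2 * θ := by
    have : θ ≤ 1 / 2 := by
      rw [hθdef, div_le_iff₀ (mul_pos hρ hD)]
      linarith
    linarith
  have hdiff : g (uθ θ) (vθ θ) - g (uθ (1 / 2)) (vθ (1 / 2))
      = -(ρ / 4) * (D - 2 * c / ρ) ^ 2 := by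
    rw [hval, hval, abs_of_nonneg hθ, hθdef]
    norm_num
    field_simp
    ring
  have hgap : D - 2 * c / ρ = 0 ↔ ρ * D = 2 * c := by
    rw [sub_eq_zero, eq_div_iff hρ.ne', mul_comm]
  refine ⟨hdiff, ?_, ?_⟩
  · have : 0 ≤ ρ / 4 * (D - 2 * c / ρ) ^ 2 := by positivity
    linarith
  · rw [← sub_eq_zero, hdiff, ← hgap]
    simp [hρ.ne']
end

section
/- Unified closed-form solution of the prox subproblem (Lemma 2.1): define θ* = min(c/(ρ·D), 1/2) if D > 0, and θ* = 1/2 if D = 0. Then (u_{θ*}, v_{θ*}), i.e., u_{θ*} = (1−θ*)·a + θ*·b − θ*·α and v_{θ*} = θ*·a + (1−θ*)·b + θ*·α, is the (unique) global minimizer of g over ℝ^d × ℝ^d. -/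
/-- Quadratic growth of the prox objective around a point of the segment
`(a - θ w, b + θ w)`, `w = a - b + α`, whose parameter satisfies the optimality conditions. -/
theorem prox_objective_quadratic_growth {E : Type*} [NormedAddCommGroup E]
    [InnerProductSpace ℝ E] (a b α u v us vs : E) {c ρ θ : ℝ} (hρ : 0 < ρ)
    (hθ0 : 0 ≤ θ) (hθ : θ ≤ 1 / 2) (hle : ρ * θ * ‖a - b + α‖ ≤ c)
    (hcompl : (1 - 2 * θ) * (c - ρ * θ * ‖a - b + α‖) = 0)
    (hus : us = a - θ • (a - b + α)) (hvs : vs = b + θ • (a - b + α)) :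
    c * ‖us + α - vs‖ + ρ / 2 * (‖a - us‖ ^ 2 + ‖b - vs‖ ^ 2)
        + ρ / 2 * (‖u - us‖ ^ 2 + ‖v - vs‖ ^ 2)
      ≤ c * ‖u + α - v‖ + ρ / 2 * (‖a - u‖ ^ 2 + ‖b - v‖ ^ 2) := by
  obtain ⟨w, hw⟩ : ∃ w, w = a - b + α := ⟨_, rfl⟩
  obtain ⟨p, hp⟩ : ∃ p, p = u - us := ⟨_, rfl⟩
  obtain ⟨q, hq⟩ : ∃ q, q = v - vs := ⟨_, rfl⟩
  rw [← hw] at hle hcompl hus hvs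
  have hz_star : us + α - vs = (1 - 2 * θ) • w := by
    rw [hus, hvs, hw]; module
  have hz : p - q = (u + α - v) - (1 - 2 * θ) • w := by
    rw [← hz_star, hp, hq]; abel
  have hau : a - us = θ • w := by rw [hus]; abel
  have hbv : b - vs = -(θ • w) := by rw [hvs]; abel
  have ha : ‖a - u‖ ^ 2 = ‖a - us‖ ^ 2 - 2 * (θ * inner ℝ w p) + ‖p‖ ^ 2 := by
    rw [show a - u = (a - us) - p by rw [hp]; abel, norm_sub_sq_real, hau,
      real_inner_smul_left]
  have hb : ‖b - v‖ ^ 2 = ‖b - vs‖ ^ 2 + 2 * (θ * inner ℝ w q) + ‖q‖ ^ 2 := by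
    rw [show b - v = (b - vs) - q by rw [hq]; abel, norm_sub_sq_real, hbv,
      inner_neg_left, real_inner_smul_left]
    ring
  have hpq : inner ℝ w p - inner ℝ w q
      = inner ℝ w (u + α - v) - (1 - 2 * θ) * ‖w‖ ^ 2 := by
    rw [← inner_sub_right, hz, inner_sub_right, real_inner_smul_right,
      real_inner_self_eq_norm_sq]
  have hnorm : ‖us + α - vs‖ = (1 - 2 * θ) * ‖w‖ := by
    rw [hz_star, norm_smul, Real.norm_of_nonneg (by linarith)]
  have hcs : ρ * θ * inner ℝ w (u + α - v) ≤ c * ‖u + α - v‖ :=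
    calc ρ * θ * inner ℝ w (u + α - v) ≤ ρ * θ * (‖w‖ * ‖u + α - v‖) := by
          gcongr
          exact real_inner_le_norm _ _
      _ = ρ * θ * ‖w‖ * ‖u + α - v‖ := by ring
      _ ≤ c * ‖u + α - v‖ := by gcongr
  rw [ha, hb, hnorm, ← hp, ← hq]
  linear_combination hcs + ‖w‖ * hcompl + ρ * θ * hpq

/-- The closed-form parameter satisfies the optimality conditions. -/
theorem prox_parameter_optimality {c ρ D θ : ℝ} (hc : 0 ≤ c) (hρ : 0 < ρ) (hD : 0 ≤ D)
    (hθ : θ = if 0 < D then min (c / (ρ * D)) (1 / 2) else 1 / 2) :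
    0 ≤ θ ∧ θ ≤ 1 / 2 ∧ ρ * θ * D ≤ c ∧ (1 - 2 * θ) * (c - ρ * θ * D) = 0 := by
  split_ifs at hθ with h
  · have hpos : 0 < ρ * D := mul_pos hρ h
    rcases le_total (c / (ρ * D)) (1 / 2) with h1 | h1
    · rw [min_eq_left h1] at hθ
      have hθc : ρ * θ * D = c := by rw [hθ]; field_simp
      exact ⟨hθ ▸ by positivity, hθ ▸ h1, hθc.le, by rw [hθc]; ring⟩
    · rw [min_eq_right h1] at hθ
      rw [le_div_iff₀ hpos] at h1
      subst hθ
      exact ⟨by norm_num, le_rfl, by linarith, by ring⟩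
  · obtain rfl : D = 0 := le_antisymm (not_lt.mp h) hD
    subst hθ
    exact ⟨by norm_num, le_rfl, by simpa using hc, by ring⟩

/-- Unified closed-form solution of the prox subproblem (Lemma 2.1): with
`θ* = min(c/(ρD), 1/2)` when `D > 0` and `θ* = 1/2` when `D = 0`, the pair
`(u_{θ*}, v_{θ*})` is the unique global minimizer of `g` over `ℝ^d × ℝ^d`. -/
theorem danr_lemma21_unified_solution
    (d : ℕ) (hd : 1 ≤ d)
    (a b α : EuclideanSpace ℝ (Fin d)) (c ρ : ℝ) (hc : 0 ≤ c) (hρ : 0 < ρ)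
    (g : EuclideanSpace ℝ (Fin d) → EuclideanSpace ℝ (Fin d) → ℝ)
    (hg : ∀ u v, g u v = c * ‖u + α - v‖ + ρ / 2 * (‖a - u‖ ^ 2 + ‖b - v‖ ^ 2))
    (D : ℝ) (hDdef : D = ‖a - b + α‖)
    (uθ vθ : ℝ → EuclideanSpace ℝ (Fin d))
    (huθ : ∀ θ : ℝ, uθ θ = (1 - θ) • a + θ • b - θ • α)
    (hvθ : ∀ θ : ℝ, vθ θ = θ • a + (1 - θ) • b + θ • α)
    (θs : ℝ) (hθs : θs = if 0 < D then min (c / (ρ * D)) (1 / 2) else 1 / 2) :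
    (∀ u v : EuclideanSpace ℝ (Fin d), g (uθ θs) (vθ θs) ≤ g u v)
    ∧ ∀ u v : EuclideanSpace ℝ (Fin d),
        (∀ u' v' : EuclideanSpace ℝ (Fin d), g u v ≤ g u' v') →
        u = uθ θs ∧ v = vθ θs := by
  subst hDdef
  obtain ⟨h0, h1, h2, h3⟩ := prox_parameter_optimality hc hρ (norm_nonneg _) hθs
  have growth : ∀ u v, g (uθ θs) (vθ θs)
      + ρ / 2 * (‖u - uθ θs‖ ^ 2 + ‖v - vθ θs‖ ^ 2) ≤ g u v := by
    intro u v
    rw [hg, hg]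
    exact prox_objective_quadratic_growth a b α u v _ _ hρ h0 h1 h2 h3
      (by rw [huθ]; module) (by rw [hvθ]; module)
  refine ⟨fun u v => le_trans (le_add_of_nonneg_right (by positivity)) (growth u v),
    fun u v hmin => ?_⟩
  have hsum : ‖u - uθ θs‖ ^ 2 + ‖v - vθ θs‖ ^ 2 ≤ 0 := by
    have := growth u v
    have := hmin (uθ θs) (vθ θs)
    exact nonpos_of_mul_nonpos_right (by linarith) (half_pos hρ)
  have hu : ‖u - uθ θs‖ ^ 2 = 0 := by
    linarith [sq_nonneg ‖u - uθ θs‖, sq_nonneg ‖v - vθ θs‖]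
  have hv : ‖v - vθ θs‖ ^ 2 = 0 := by
    linarith [sq_nonneg ‖u - uθ θs‖, sq_nonneg ‖v - vθ θs‖]
  rw [sq_eq_zero_iff, norm_sub_eq_zero_iff] at hu hv
  exact ⟨hu, hv⟩
end
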